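/- Let G be a finite connected simple graph on 9 vertices with 2 ≤ δ(G) ≤ Δ(G) ≤ 3. If there exist adjacent vertices u₁, u₂, both of degree 3, and a vertex z different from u₁ and u₂, such that N̄(u₁) ∩ N̄(u₂) = {u₁, u₂, z} (i.e., u₁ and u₂ are adjacent and have exactly one common neighbor), then c_L(G) ≤ 2. -/

import Mathlib

/-!
Cops and robbers on a simple graph `G`.

A *configuration* consists of the positions of the `k` cops (a function
`Fin k → V`) together with the robber's position, with the cops to move.
The cops win if at some point a cop occupies the robber's vertex.
-/

namespace CopsRobbers

variable {V : Type*}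

/-- From cop positions `c` and robber position `r`, with the cops to move,
the cops (each of whom may move along an edge or stay put on the cops' turn)
can guarantee to catch the robber.  Either a cop is already on the robber,
or the cops can move so that a cop lands on the robber, or the cops can move
so that whatever (legal) move the robber then makes, the resulting
configuration is again winning for the cops. -/
inductive CopsWinFrom (G : SimpleGraph V) {k : ℕ} : (Fin k → V) → V → Prop
  | caught {c : Fin k → V} {r : V} (i : Fin k) (h : c i = r) : CopsWinFrom G c r
  | stepCatch {c : Fin k → V} {r : V} (c' : Fin k → V)
      (hmove : ∀ i, c' i = c i ∨ G.Adj (c i) (c' i))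
      (i : Fin k) (h : c' i = r) : CopsWinFrom G c r
  | step {c : Fin k → V} {r : V} (c' : Fin k → V)
      (hmove : ∀ i, c' i = c i ∨ G.Adj (c i) (c' i))
      (hnext : ∀ r', (r' = r ∨ G.Adj r r') → CopsWinFrom G c' r') :
      CopsWinFrom G c r

/-- `k` cops have a winning strategy on `G` in the ordinary game: they choose
starting positions, and then whatever vertex the robber starts on, they can
catch him. -/
def CopsWin (G : SimpleGraph V) (k : ℕ) : Prop :=
  ∃ c₀ : Fin k → V, ∀ r₀ : V, CopsWinFrom G c₀ r₀

/-- The cop number `c(G)`: the least number of cops that have a winning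
strategy on `G`. -/
noncomputable def copNumber (G : SimpleGraph V) : ℕ :=
  sInf {k | CopsWin G k}

/-- The lazy variant: from cop positions `c` and robber position `r`, with the
cops to move, the cops can catch the robber, where on each cops' turn at most
one cop (cop `j`) moves along an edge (all others stay put). -/
inductive LazyWinFrom (G : SimpleGraph V) {k : ℕ} : (Fin k → V) → V → Prop
  | caught {c : Fin k → V} {r : V} (i : Fin k) (h : c i = r) : LazyWinFrom G c r
  | stepCatch {c : Fin k → V} {r : V} (c' : Fin k → V) (j : Fin k)
      (hmove : c' j = c j ∨ G.Adj (c j) (c' j))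
      (hfix : ∀ i, i ≠ j → c' i = c i)
      (i : Fin k) (h : c' i = r) : LazyWinFrom G c r
  | step {c : Fin k → V} {r : V} (c' : Fin k → V) (j : Fin k)
      (hmove : c' j = c j ∨ G.Adj (c j) (c' j))
      (hfix : ∀ i, i ≠ j → c' i = c i)
      (hnext : ∀ r', (r' = r ∨ G.Adj r r') → LazyWinFrom G c' r') :
      LazyWinFrom G c r

/-- `k` lazy cops have a winning strategy on `G`. -/
def LazyCopsWin (G : SimpleGraph V) (k : ℕ) : Prop :=
  ∃ c₀ : Fin k → V, ∀ r₀ : V, LazyWinFrom G c₀ r₀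

/-- The lazy cop number `c_L(G)`. -/
noncomputable def lazyCopNumber (G : SimpleGraph V) : ℕ :=
  sInf {k | LazyCopsWin G k}

/-- A dominating set: every vertex is in `S` or adjacent to a member of `S`. -/
def IsDominatingSet (G : SimpleGraph V) (S : Set V) : Prop :=
  ∀ v : V, v ∈ S ∨ ∃ u ∈ S, G.Adj u v

/-- The domination number `γ(G)`: the least size of a dominating set. -/
noncomputable def dominationNumber (G : SimpleGraph V) [Fintype V] : ℕ :=
  sInf {m | ∃ S : Finset V, S.card = m ∧ IsDominatingSet G ↑S}

/-- The `n × n` rooks graph `K_n □ K_n`. -/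
def rooksGraph (n : ℕ) : SimpleGraph (Fin n × Fin n) :=
  SimpleGraph.boxProd ⊤ ⊤


/-- A single cop at `c` can catch a robber at `r` who is confined to `H`; the cop may use all
of `G`. -/
inductive CatchIn (G : SimpleGraph V) (H : Set V) : V → V → Prop
  | caught (c : V) : CatchIn G H c c
  | step {c r : V} (c' : V) (hmove : c' = c ∨ G.Adj c c')
      (hnext : c' ≠ r → ∀ r' ∈ H, (r' = r ∨ G.Adj r r') → CatchIn G H c' r') :
      CatchIn G H c r

/-- `H` can be emptied by repeatedly deleting a vertex that is isolated in `H` or whose closed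
neighborhood in `H` is contained in the closed neighborhood of another vertex of `H`. -/
inductive Dismantles (G : SimpleGraph V) : Set V → Prop
  | empty : Dismantles G ∅
  | isolated {H : Set V} (v : V) (hv : ∀ x ∈ H, ¬ G.Adj v x)
      (h : Dismantles G (H \ {v})) : Dismantles G H
  | corner {H : Set V} (v w : V) (hw : w ∈ H) (hwv : G.Adj w v)
      (hsub : ∀ x ∈ H, G.Adj v x → x = w ∨ G.Adj w x)
      (h : Dismantles G (H \ {v})) : Dismantles G H

theorem CatchIn.of_adj {G : SimpleGraph V} {H : Set V} {c r : V} (h : r = c ∨ G.Adj c r) :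
    CatchIn G H c r :=
  .step r h fun hne => absurd rfl hne

theorem CatchIn.of_isolated {G : SimpleGraph V} {H : Set V} {v : V}
    (hv : ∀ x ∈ H, ¬ G.Adj v x) {c r : V} (h : CatchIn G (H \ {v}) c r)
    (hr : r ∈ H \ {v}) : CatchIn G H c r := by
  induction h with
  | caught c => exact .caught c
  | step c' hmove _ ih =>
    refine .step c' hmove fun hne r' hr' hadj => ?_
    have hr'v : r' ∈ H \ {v} := by
      refine ⟨hr', fun h => ?_⟩
      rw [Set.mem_singleton_iff] at h
      subst h
      rcases hadj with rfl | hadj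
      · exact hr.2 rfl
      · exact hv _ hr.1 hadj.symm
    exact ih hne r' hr'v hadj hr'v

theorem CatchIn.of_walk {G : SimpleGraph V} {H : Set V} {c v : V}
    (hv : ∀ x ∈ H, ¬ G.Adj v x) (p : G.Walk c v) : CatchIn G H c v := by
  induction p with
  | nil => exact .caught _
  | cons h _ ih =>
    refine .step _ (.inr h) fun _ r' hr' hadj => ?_
    rcases hadj with rfl | hadj
    · exact ih hv
    · exact absurd hadj (hv _ hr')

/-- The cop plays against the image of the robber under the retraction sending the corner `v`
to the vertex `w` dominating it. -/
theorem CatchIn.of_corner {G : SimpleGraph V} {H : Set V} {v w : V} (hw : w ∈ H)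
    (hwv : G.Adj w v) (hsub : ∀ x ∈ H, G.Adj v x → x = w ∨ G.Adj w x) {c s : V}
    (h : CatchIn G (H \ {v}) c s) :
    ∀ r ∈ H, (s = r ∧ r ≠ v ∨ r = v ∧ s = w) → CatchIn G H c r := by
  have hwne : w ∈ H \ {v} := ⟨hw, hwv.ne⟩
  induction h with
  | caught c =>
    rintro r - (⟨rfl, -⟩ | ⟨rfl, rfl⟩)
    · exact .caught _
    · exact .of_adj (.inr hwv)
  | @step c s c' hmove _ ih =>
    rintro r hr (⟨rfl, hne⟩ | ⟨rfl, rfl⟩)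
    · refine .step c' hmove fun hc r' hr' hadj => ?_
      by_cases hr'v : r' = v
      · subst hr'v
        refine ih hc w hwne ?_ _ hr' (.inr ⟨rfl, rfl⟩)
        rcases hadj with h | h
        · exact absurd h.symm hne
        · rcases hsub _ hr h.symm with h | h
          · exact .inl h.symm
          · exact .inr h.symm
      · exact ih hc r' ⟨hr', hr'v⟩ hadj r' hr' (.inl ⟨rfl, hr'v⟩)
    · have key : ∀ r' ∈ H, (r' = r ∨ G.Adj r r') → r' ≠ r → r' = s ∨ G.Adj s r' :=
        fun r' hr' hadj hne => hsub r' hr' (hadj.resolve_left hne)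
      refine .step c' hmove fun _ r' hr' hadj => ?_
      by_cases hc : c' = s
      · subst hc
        by_cases hne : r' = r
        · subst hne
          exact .of_adj (.inr hwv)
        · exact .of_adj (key r' hr' hadj hne)
      · by_cases hne : r' = r
        · exact ih hc s hwne (.inl rfl) r' hr' (.inr ⟨hne, rfl⟩)
        · exact ih hc r' ⟨hr', hne⟩ (key r' hr' hadj hne) r' hr' (.inl ⟨rfl, hne⟩)

theorem Dismantles.catchIn {G : SimpleGraph V} (hconn : G.Connected) {H : Set V}
    (h : Dismantles G H) : ∀ c, ∀ r ∈ H, CatchIn G H c r := by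
  classical
  induction h with
  | empty => exact fun _ _ hr => absurd hr (Set.notMem_empty _)
  | @isolated H v hv _ ih =>
    intro c r hr
    by_cases hrv : r = v
    · subst hrv
      exact .of_walk hv (hconn.preconnected c r).some
    · exact .of_isolated hv (ih c r ⟨hr, hrv⟩) ⟨hr, hrv⟩
  | @corner H v w hw hwv hsub _ ih =>
    intro c r hr
    by_cases hrv : r = v
    · exact .of_corner hw hwv hsub (ih c w ⟨hw, hwv.ne⟩) r hr (.inr ⟨hrv, rfl⟩)
    · exact .of_corner hw hwv hsub (ih c r ⟨hr, hrv⟩) r hr (.inl ⟨rfl, hrv⟩)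

theorem LazyWinFrom.of_guarded {G : SimpleGraph V} {u c r : V} (hr : r = u ∨ G.Adj u r) :
    LazyWinFrom G ![u, c] r := by
  refine .stepCatch ![r, c] 0 (by simpa using hr) ?_ 0 rfl
  intro i hi
  fin_cases i
  · exact absurd rfl hi
  · rfl

/-- One cop guards the closed neighborhood of `u` while the other one hunts the robber in the
rest of the graph. -/
theorem LazyWinFrom.of_catchIn {G : SimpleGraph V} {H : Set V} {u c r : V}
    (hH : ∀ x ∉ H, x = u ∨ G.Adj u x) (h : CatchIn G H c r) : LazyWinFrom G ![u, c] r := by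
  induction h with
  | caught c => exact .caught 1 rfl
  | @step c r c' hmove _ ih =>
    have hfix : ∀ i : Fin 2, i ≠ 1 → ![u, c'] i = ![u, c] i := by
      intro i hi
      fin_cases i
      · rfl
      · exact absurd rfl hi
    by_cases hc : c' = r
    · exact .stepCatch ![u, c'] 1 (by simpa using hmove) hfix 1 hc
    · refine .step ![u, c'] 1 (by simpa using hmove) hfix fun r' hadj => ?_
      by_cases hr' : r' ∈ H
      · exact ih hc r' hr' hadj
      · exact .of_guarded (hH r' hr')

theorem lazyCopNumber_le_two_of_dismantles {G : SimpleGraph V} (hconn : G.Connected) {H : Set V}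
    {u : V} (hH : ∀ x ∉ H, x = u ∨ G.Adj u x) (h : Dismantles G H) : lazyCopNumber G ≤ 2 := by
  refine Nat.sInf_le ⟨![u, u], fun r => ?_⟩
  by_cases hr : r ∈ H
  · exact .of_catchIn hH (h.catchIn hconn u r hr)
  · exact .of_guarded (hH r hr)

/-! ### Searching through partially known graphs on nine vertices

A partially known graph on `{0, …, 8}` is a pair of `81`-bit masks: bit `9 * i + j` of the first
(second) mask is set if `i` and `j` are known to be adjacent (nonadjacent). -/

/-- Bit `9 * i + j` of a mask, written with the primitive operations on `ℕ` so that it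
evaluates quickly. -/
def entry (m i j : ℕ) : Bool := Nat.beq (Nat.land 1 (Nat.shiftRight m (Nat.add (Nat.mul 9 i) j))) 1

/-- The `i`-th row of a mask. -/
def row (m i : ℕ) : ℕ := (m >>> (9 * i)) &&& 511

/-- The mask of the single edge `ij`. -/
def edgeMask (i j : ℕ) : ℕ := 2 ^ (9 * i + j) ||| 2 ^ (9 * j + i)

/-- The vertex `v` of `H` is certainly isolated in `H` or dominated by another vertex of `H`. -/
def removable (y n H v : ℕ) : Bool :=
  H.testBit v &&
    (((row n v ||| 2 ^ v) &&& H == H) ||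
      (List.range 9).any fun w => H.testBit w && (entry y w v &&
        ((row n v ||| row y w ||| 2 ^ w ||| 2 ^ v) &&& H == H)))

/-- Greedy dismantling of `H` in at most `k` steps. -/
def dismantle (y n : ℕ) : ℕ → ℕ → Bool
  | 0, H => H == 0
  | k + 1, H => H == 0 ||
      match (List.range 9).find? (removable y n H) with
      | none => false
      | some v => dismantle y n k (H ^^^ 2 ^ v)

/-- The number of known neighbors of `v`. -/
def minDeg (y v : ℕ) : ℕ := (List.range 9).countP fun j => entry y v j

/-- The number of potential neighbors of `v`. -/
def maxDeg (n v : ℕ) : ℕ := (List.range 9).countP fun j => !(j == v || entry n v j)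

/-- For one of the vertices in `us`, the set of the vertices not known to be in its closed
neighborhood can be dismantled. -/
def guardable (y n : ℕ) (us : List ℕ) : Bool :=
  us.any fun u => dismantle y n 9 (511 ^^^ ((row y u ||| 2 ^ u) &&& 511))

/-- No vertex in `{0, …, 4}` is adjacent to one in `{5, …, 8}`. -/
def splits (n : ℕ) : Bool :=
  (List.range 5).all fun i => (List.range 9).all fun j => decide (j < 5) || entry n i j

/-- Decide the pairs in the list one after the other, in both ways, and check that each branch
leads to a violated degree condition, to a guardable graph or to a disconnected graph. -/
def search : List (ℕ × ℕ × List ℕ) → ℕ → ℕ → Bool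
  | [], _, n => splits n
  | (i, j, us) :: ps, y, n =>
    (decide (3 < minDeg (y ||| edgeMask i j) i) || decide (3 < minDeg (y ||| edgeMask i j) j) ||
      guardable (y ||| edgeMask i j) n us || search ps (y ||| edgeMask i j) n) &&
    (decide (maxDeg (n ||| edgeMask i j) i < 2) || decide (maxDeg (n ||| edgeMask i j) j < 2) ||
      guardable y (n ||| edgeMask i j) us || search ps y (n ||| edgeMask i j))

/-- The mask of the graph with the given edges. -/
def edgesMask (es : List (Fin 9 × Fin 9)) : ℕ := es.foldr (fun e m => m ||| edgeMask e.1 e.2) 0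

/-- The order in which the pairs are decided. -/
def searchOrder : List (ℕ × ℕ × List ℕ) :=
  [(0, 4, []), (0, 5, []), (0, 6, []), (0, 7, []), (0, 8, []),
   (1, 3, []), (1, 5, []), (1, 6, []), (1, 7, []), (1, 8, []),
   (4, 5, []), (4, 6, []), (4, 7, []), (4, 8, []),
   (5, 6, []), (5, 7, []), (5, 8, []), (6, 7, []), (6, 8, []), (7, 8, [0]),
   (3, 5, []), (3, 6, []), (3, 7, []), (3, 8, [1]), (3, 4, []),
   (2, 5, []), (2, 6, []), (2, 7, []), (2, 8, [2, 3, 4, 5, 6, 7, 8]), (2, 3, []),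
   (2, 4, [2, 3, 4, 5, 6, 7, 8])]

theorem search_searchOrder :
    search searchOrder (edgesMask [(0, 1), (0, 2), (1, 2), (0, 3), (1, 4)]) 0 = true := by
  decide +kernel

theorem entry_eq_testBit (m i j : ℕ) : entry m i j = m.testBit (9 * i + j) := by
  have h : entry m i j = (1 &&& m >>> (9 * i + j) == 1) := by
    rw [Bool.eq_iff_iff, beq_iff_eq]
    exact Iff.of_eq Nat.beq_eq
  rw [h, Nat.testBit]
  rcases Nat.mod_two_eq_zero_or_one (m >>> (9 * i + j)) with h | h <;>
    simp [Nat.one_and_eq_mod_two, h]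

theorem testBit_row {m i j : ℕ} (h : (row m i).testBit j = true) : entry m i j = true := by
  rw [row, Nat.testBit_and, Nat.testBit_shiftRight, Bool.and_eq_true] at h
  rw [entry_eq_testBit]
  exact h.1

theorem testBit_two_pow_eq {i j : ℕ} (h : (2 ^ i).testBit j = true) : i = j := by
  simpa [Nat.testBit_two_pow] using h

theorem testBit_of_and_beq {A H j : ℕ} (h : (A &&& H == H) = true) (hj : H.testBit j = true) :
    A.testBit j = true := by
  rw [← beq_iff_eq.mp h, Nat.testBit_and, Bool.and_eq_true] at hj
  exact hj.1

theorem entry_or_edgeMask {m i j a b : ℕ} (hi : i < 9) (hj : j < 9) (hb : b < 9)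
    (h : entry (m ||| edgeMask i j) a b = true) :
    entry m a b = true ∨ a = i ∧ b = j ∨ a = j ∧ b = i := by
  rw [entry_eq_testBit, Nat.testBit_or, edgeMask, Nat.testBit_or, Bool.or_eq_true,
    Bool.or_eq_true] at h
  rw [entry_eq_testBit]
  rcases h with h | h | h
  · exact .inl h
  · have := testBit_two_pow_eq h
    omega
  · have := testBit_two_pow_eq h
    omega

theorem countP_range (k : ℕ) (p : ℕ → Bool) :
    (List.range k).countP p = ((Finset.range k).filter fun j => p j = true).card := by
  simp [Finset.card, Finset.filter, Finset.range, Multiset.range, List.countP_eq_length_filter]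

/-- With the vertices of `G` labelled by `g`, the masks `y` and `n` hold true information. -/
structure Known (G : SimpleGraph V) (g : V ≃ Fin 9) (y n : ℕ) : Prop where
  adj : ∀ a b, entry y (g a) (g b) = true → G.Adj a b
  not_adj : ∀ a b, entry n (g a) (g b) = true → ¬ G.Adj a b

namespace Known

variable {G : SimpleGraph V} {g : V ≃ Fin 9} {y n : ℕ}

theorem insert_adj (h : Known G g y n) {i j : Fin 9} (hij : G.Adj (g.symm i) (g.symm j)) :
    Known G g (y ||| edgeMask i j) n := by
  refine ⟨fun a b hab => ?_, h.not_adj⟩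
  rcases entry_or_edgeMask i.2 j.2 (g b).2 hab with hab | ⟨h1, h2⟩ | ⟨h1, h2⟩
  · exact h.adj a b hab
  · rw [Fin.val_inj, ← Equiv.eq_symm_apply] at h1 h2
    rwa [h1, h2]
  · rw [Fin.val_inj, ← Equiv.eq_symm_apply] at h1 h2
    rw [h1, h2]
    exact hij.symm

theorem insert_not_adj (h : Known G g y n) {i j : Fin 9}
    (hij : ¬ G.Adj (g.symm i) (g.symm j)) : Known G g y (n ||| edgeMask i j) := by
  refine ⟨h.adj, fun a b hab => ?_⟩
  rcases entry_or_edgeMask i.2 j.2 (g b).2 hab with hab | ⟨h1, h2⟩ | ⟨h1, h2⟩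
  · exact h.not_adj a b hab
  · rw [Fin.val_inj, ← Equiv.eq_symm_apply] at h1 h2
    rwa [h1, h2]
  · rw [Fin.val_inj, ← Equiv.eq_symm_apply] at h1 h2
    rw [h1, h2]
    exact fun hadj => hij hadj.symm

theorem dismantles_of_removable (h : Known G g y n) {H v : ℕ} (hv : v < 9)
    (hrem : removable y n H v = true)
    (hd : Dismantles G {x | (H ^^^ 2 ^ v).testBit (g x) = true}) :
    Dismantles G {x | H.testBit (g x) = true} := by
  obtain ⟨a, rfl⟩ : ∃ a, v = g a := ⟨g.symm ⟨v, hv⟩, by simp⟩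
  simp only [removable, Bool.and_eq_true, Bool.or_eq_true, List.any_eq_true, List.mem_range]
    at hrem
  obtain ⟨haH, hrem⟩ := hrem
  have hset : {x | (H ^^^ 2 ^ (g a : ℕ)).testBit (g x) = true} =
      {x | H.testBit (g x) = true} \ {a} := by
    ext x
    by_cases hx : x = a
    · simp [hx, Nat.testBit_xor, haH]
    · have : ¬ (g a : ℕ) = g x := fun h => hx (g.injective (Fin.ext h)).symm
      simp [hx, Nat.testBit_xor, Nat.testBit_two_pow, this]
  rw [hset] at hd
  rcases hrem with hiso | ⟨w, hw, hwH, hwv, hsub⟩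
  · refine .isolated a (fun x hx hax => ?_) hd
    have hx := testBit_of_and_beq hiso hx
    rw [Nat.testBit_or, Bool.or_eq_true] at hx
    rcases hx with hx | hx
    · exact h.not_adj _ _ (testBit_row hx) hax
    · exact hax.ne (g.injective (Fin.ext (testBit_two_pow_eq hx)))
  · obtain ⟨b, rfl⟩ : ∃ b, w = g b := ⟨g.symm ⟨w, hw⟩, by simp⟩
    refine .corner a b hwH (h.adj _ _ hwv) (fun x hx hax => ?_) hd
    have hx := testBit_of_and_beq hsub hx
    rw [Nat.testBit_or, Nat.testBit_or, Nat.testBit_or, Bool.or_eq_true, Bool.or_eq_true,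
      Bool.or_eq_true] at hx
    rcases hx with ((hx | hx) | hx) | hx
    · exact absurd hax (h.not_adj _ _ (testBit_row hx))
    · exact .inr (h.adj _ _ (testBit_row hx))
    · exact .inl (g.injective (Fin.ext (testBit_two_pow_eq hx))).symm
    · exact absurd (g.injective (Fin.ext (testBit_two_pow_eq hx))) hax.ne

theorem dismantles_of_dismantle (h : Known G g y n) (k H : ℕ) (hd : dismantle y n k H = true) :
    Dismantles G {x | H.testBit (g x) = true} := by
  have hzero : ∀ H : ℕ, (H == 0) = true → Dismantles G {x | H.testBit (g x) = true} := by
    intro H hH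
    rw [beq_iff_eq.mp hH]
    simpa using Dismantles.empty (G := G)
  induction k generalizing H with
  | zero => exact hzero H hd
  | succ k ih =>
    rw [dismantle, Bool.or_eq_true] at hd
    rcases hd with hd | hd
    · exact hzero H hd
    · split at hd
      · cases hd
      · next v hv =>
        exact h.dismantles_of_removable (List.mem_range.mp (List.mem_of_find?_eq_some hv))
          (List.find?_some hv) (ih _ hd)

theorem lazyCopNumber_le_two_of_guardable (h : Known G g y n) (hconn : G.Connected)
    {us : List ℕ} (hus : ∀ u ∈ us, u < 9) (hg : guardable y n us = true) :
    lazyCopNumber G ≤ 2 := by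
  obtain ⟨u, hu, hd⟩ := List.any_eq_true.mp hg
  obtain ⟨a, rfl⟩ : ∃ a, u = g a := ⟨g.symm ⟨u, hus u hu⟩, by simp⟩
  refine lazyCopNumber_le_two_of_dismantles hconn (u := a) (fun x hx => ?_)
    (h.dismantles_of_dismantle 9 _ hd)
  have hlt : (511 : ℕ).testBit (g x) = true := by
    rw [show 511 = 2 ^ 9 - 1 from rfl, Nat.testBit_two_pow_sub_one]
    exact decide_eq_true (g x).2
  rw [Set.mem_ofPred_eq, Nat.testBit_xor, Nat.testBit_and, hlt, Bool.and_true, Bool.true_xor,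
    Bool.not_eq_true', Bool.not_eq_false, Nat.testBit_or, Bool.or_eq_true] at hx
  rcases hx with hx | hx
  · exact .inr (h.adj _ _ (testBit_row hx))
  · exact .inl (g.injective (Fin.ext (testBit_two_pow_eq hx))).symm

theorem not_splits (h : Known G g y n) (hconn : G.Connected) : splits n = false := by
  rw [← Bool.not_eq_true]
  intro hs
  have hcross : ∀ a b, (g a : ℕ) < 5 → G.Adj a b → (g b : ℕ) < 5 := by
    intro a b ha hab
    simp only [splits, List.all_eq_true, List.mem_range, Bool.or_eq_true, decide_eq_true_eq] at hs
    exact (hs _ ha _ (g b).2).resolve_right fun hn => h.not_adj a b hn hab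
  have hwalk : ∀ a b, G.Walk a b → (g a : ℕ) < 5 → (g b : ℕ) < 5 := by
    intro a b p
    induction p with
    | nil => exact id
    | cons hadj _ ih => exact fun ha => ih (hcross _ _ ha hadj)
  have h8 := hwalk (g.symm 0) (g.symm 8) (hconn.preconnected _ _).some (by simp)
  rw [Equiv.apply_symm_apply] at h8
  exact absurd h8 (by decide)

theorem minDeg_le [Fintype V] [DecidableRel G.Adj] (h : Known G g y n) (i : Fin 9) :
    minDeg y i ≤ G.degree (g.symm i) := by
  classical
  rw [minDeg, countP_range, ← G.card_neighborFinset_eq_degree]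
  refine (Finset.card_le_card (t := (G.neighborFinset (g.symm i)).image fun x => (g x : ℕ))
    fun j hj => ?_).trans Finset.card_image_le
  rw [Finset.mem_filter, Finset.mem_range] at hj
  refine Finset.mem_image.mpr ⟨g.symm ⟨j, hj.1⟩, ?_, by simp⟩
  exact (G.mem_neighborFinset _ _).mpr (h.adj _ _ (by simpa using hj.2))

theorem degree_le [Fintype V] [DecidableRel G.Adj] (h : Known G g y n) (i : Fin 9) :
    G.degree (g.symm i) ≤ maxDeg n i := by
  classical
  rw [maxDeg, countP_range, ← G.card_neighborFinset_eq_degree,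
    ← Finset.card_image_of_injective (f := fun x => (g x : ℕ)) (G.neighborFinset (g.symm i))
      (Fin.val_injective.comp g.injective)]
  refine Finset.card_le_card fun j hj => ?_
  obtain ⟨x, hx, rfl⟩ := Finset.mem_image.mp hj
  rw [SimpleGraph.mem_neighborFinset] at hx
  refine Finset.mem_filter.mpr ⟨Finset.mem_range.mpr (g x).2, ?_⟩
  have hne : ¬ (g x : ℕ) = i := fun he => hx.ne (g.symm_apply_eq.mpr (Fin.ext he).symm)
  have hn : ¬ entry n i (g x) = true := fun hn => h.not_adj (g.symm i) x (by simpa using hn) hx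
  simp [hne, hn]

theorem lazyCopNumber_le_two_of_search [Fintype V] [DecidableRel G.Adj] (hconn : G.Connected)
    (hdeg : ∀ v, 2 ≤ G.degree v ∧ G.degree v ≤ 3) {ps : List (ℕ × ℕ × List ℕ)}
    (hps : ∀ p ∈ ps, p.1 < 9 ∧ p.2.1 < 9 ∧ ∀ u ∈ p.2.2, u < 9) (h : Known G g y n)
    (hs : search ps y n = true) : lazyCopNumber G ≤ 2 := by
  induction ps generalizing y n with
  | nil => simp [search, h.not_splits hconn] at hs
  | cons p ps ih =>
    obtain ⟨i, j, us⟩ := p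
    obtain ⟨hi, hj, hus⟩ := hps _ List.mem_cons_self
    replace ih := fun y n => ih (y := y) (n := n) fun p hp => hps p (List.mem_cons_of_mem _ hp)
    lift i to Fin 9 using hi
    lift j to Fin 9 using hj
    simp only [search, Bool.and_eq_true, Bool.or_eq_true, decide_eq_true_eq] at hs
    by_cases hij : G.Adj (g.symm i) (g.symm j)
    · have h' := h.insert_adj hij
      rcases hs.1 with ((hs | hs) | hs) | hs
      · exact absurd (hs.trans_le (h'.minDeg_le i)) (not_lt.mpr (hdeg _).2)
      · exact absurd (hs.trans_le (h'.minDeg_le j)) (not_lt.mpr (hdeg _).2)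
      · exact h'.lazyCopNumber_le_two_of_guardable hconn hus hs
      · exact ih _ _ h' hs
    · have h' := h.insert_not_adj hij
      rcases hs.2 with ((hs | hs) | hs) | hs
      · exact absurd ((h'.degree_le i).trans_lt hs) (not_lt.mpr (hdeg _).1)
      · exact absurd ((h'.degree_le j).trans_lt hs) (not_lt.mpr (hdeg _).1)
      · exact h'.lazyCopNumber_le_two_of_guardable hconn hus hs
      · exact ih _ _ h' hs

theorem of_edges (es : List (Fin 9 × Fin 9))
    (hes : ∀ e ∈ es, G.Adj (g.symm e.1) (g.symm e.2)) : Known G g (edgesMask es) 0 := by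
  induction es with
  | nil =>
    have hzero : ∀ a b, ¬ entry 0 a b = true := by simp [entry_eq_testBit]
    exact ⟨fun _ _ h => absurd h (hzero _ _), fun _ _ h => absurd h (hzero _ _)⟩
  | cons e es ih =>
    exact (ih fun e he => hes e (List.mem_cons_of_mem _ he)).insert_adj
      (hes e List.mem_cons_self)

end Known


/-- 9 vertices, `2 ≤ δ(G) ≤ Δ(G) ≤ 3`, and two adjacent
degree-3 vertices with exactly one common neighbor `z` imply `c_L(G) ≤ 2`. -/
theorem lazy_le_two_of_adjacent_one_common_neighbor
    {V : Type*} [Fintype V] [Nonempty V] (G : SimpleGraph V)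
    [DecidableRel G.Adj] (hconn : G.Connected)
    (hcard : Fintype.card V = 9)
    (hδ : 2 ≤ G.minDegree) (hΔ : G.maxDegree ≤ 3)
    (u₁ u₂ : V) (h1 : G.degree u₁ = 3) (h2 : G.degree u₂ = 3)
    (hadj : G.Adj u₁ u₂)
    (z : V) (hz1 : z ≠ u₁) (hz2 : z ≠ u₂)
    (hN : insert u₁ (G.neighborSet u₁) ∩ insert u₂ (G.neighborSet u₂) =
      {u₁, u₂, z}) :
    lazyCopNumber G ≤ 2 := by
  classical
  have hz : (z = u₁ ∨ G.Adj u₁ z) ∧ (z = u₂ ∨ G.Adj u₂ z) := by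
    have hmem : z ∈ insert u₁ (G.neighborSet u₁) ∩ insert u₂ (G.neighborSet u₂) := by
      rw [hN]
      simp
    exact hmem
  have hz₁ : G.Adj u₁ z := hz.1.resolve_left hz1
  have hz₂ : G.Adj u₂ z := hz.2.resolve_left hz2
  have hthird : ∀ u v, G.degree u = 3 → ∃ w, G.Adj u w ∧ w ≠ v ∧ w ≠ z := by
    intro u v hu
    obtain ⟨w, hw, hwne⟩ := Finset.exists_mem_notMem_of_card_lt_card
      (s := {v, z}) (t := G.neighborFinset u)
      (by rw [G.card_neighborFinset_eq_degree, hu]; exact Finset.card_le_two.trans_lt (by decide))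
    exact ⟨w, (G.mem_neighborFinset _ _).mp hw, by simpa [not_or] using hwne⟩
  obtain ⟨a, ha, ha₂, haz⟩ := hthird u₁ u₂ h1
  obtain ⟨b, hb, hb₁, hbz⟩ := hthird u₂ u₁ h2
  have hab : a ≠ b := by
    rintro rfl
    have hmem : a ∈ insert u₁ (G.neighborSet u₁) ∩ insert u₂ (G.neighborSet u₂) :=
      ⟨.inr ha, .inr hb⟩
    rw [hN] at hmem
    rcases hmem with h | h | h
    exacts [hb₁ h, ha₂ h, haz h]
  obtain ⟨e, he⟩ := Finset.exists_equiv_extend_of_card_eq (α := Fin 9) (β := V)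
    (t := Finset.univ) (by rw [Finset.card_univ, hcard, Fintype.card_fin])
    (s := {0, 1, 2, 3, 4}) (f := ![u₁, u₂, z, a, b, u₁, u₁, u₁, u₁]) (Finset.subset_univ _)
    (by
      have := hadj.ne
      have := ha.ne
      have := hb.ne
      intro i hi j hj hij
      simp only [Finset.coe_insert, Finset.coe_singleton, Set.mem_insert_iff,
        Set.mem_singleton_iff] at hi hj
      rcases hi with rfl | rfl | rfl | rfl | rfl <;>
        rcases hj with rfl | rfl | rfl | rfl | rfl <;> simp_all)
  let g : V ≃ Fin 9 := (e.trans (Equiv.subtypeUnivEquiv Finset.mem_univ)).symm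
  have hg : ∀ i ∈ ({0, 1, 2, 3, 4} : Finset (Fin 9)),
      g.symm i = ![u₁, u₂, z, a, b, u₁, u₁, u₁, u₁] i := he
  refine Known.lazyCopNumber_le_two_of_search (g := g) hconn
    (fun v => ⟨hδ.trans (G.minDegree_le_degree v), (G.degree_le_maxDegree v).trans hΔ⟩)
    (by decide) (.of_edges [(0, 1), (0, 2), (1, 2), (0, 3), (1, 4)] ?_) search_searchOrder
  simp [hg, hadj, hz₁, hz₂, ha, hb]

end CopsRobbers
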